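/- Let λ be a real number, let r be a positive natural number, and let Hr : ℕ → ℕ → ℝ satisfy Hr(n,k) = 0 for k > n and, for all natural numbers n and all real x, ⟨x + r⟩_{n,λ} = Σ_{k=0}^{n} Hr(n,k) · (x)_k (so Hr(n,k) = H_λ^{(r)}(n+r, k+r), the heterogeneous r-Stirling numbers of the second kind). Then for all natural numbers n and k: Hr(n+1, k+1) = Hr(n, k) + (k + 1 + r + nλ) · Hr(n, k+1), and Hr(n+1, 0) = (r + nλ) · Hr(n, 0). -/

import Mathlib

/-- The falling factorials `x (x - 1) ⋯ (x - k + 1)` are linearly independent as functions of `x`. -/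
theorem eq_zero_of_sum_mul_fallingFactorial_eq_zero (N : ℕ) (a : ℕ → ℝ)
    (h : ∀ x : ℝ, ∑ k ∈ Finset.range N, a k * ∏ i ∈ Finset.range k, (x - (i : ℝ)) = 0)
    (k : ℕ) (hk : k < N) : a k = 0 := by
  induction k using Nat.strong_induction_on with
  | _ k ih =>
    have hx := h k
    rw [Finset.sum_eq_single_of_mem k (Finset.mem_range.2 hk)] at hx
    · refine (mul_eq_zero.1 hx).resolve_right (Finset.prod_ne_zero_iff.2 fun i hi => ?_)
      exact sub_ne_zero.2 (Nat.cast_injective.ne (Finset.mem_range.1 hi).ne')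
    · intro j hj hjk
      rcases hjk.lt_or_gt with hlt | hgt
      · rw [ih j hlt (Finset.mem_range.1 hj), zero_mul]
      · rw [Finset.prod_eq_zero (Finset.mem_range.2 hgt) (sub_self _), mul_zero]


/-- Recurrence for the heterogeneous r-Stirling numbers of the second kind:
`Hr(n+1,k+1) = Hr(n,k) + (k+1+r+nλ) Hr(n,k+1)` and `Hr(n+1,0) = (r+nλ) Hr(n,0)`. -/
theorem heterogeneous_r_stirling_recurrence (l : ℝ) (r : ℕ) (hr : 0 < r)
    (Hr : ℕ → ℕ → ℝ)
    (hHr0 : ∀ n k, n < k → Hr n k = 0)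
    (hHr : ∀ (n : ℕ) (x : ℝ),
      (∏ i ∈ Finset.range n, (x + (r : ℝ) + (i : ℝ) * l)) =
        ∑ k ∈ Finset.range (n + 1), Hr n k * ∏ i ∈ Finset.range k, (x - (i : ℝ))) :
    (∀ n k : ℕ, Hr (n + 1) (k + 1) =
        Hr n k + ((k : ℝ) + 1 + (r : ℝ) + (n : ℝ) * l) * Hr n (k + 1)) ∧
    (∀ n : ℕ, Hr (n + 1) 0 = ((r : ℝ) + (n : ℝ) * l) * Hr n 0) := by
  have key (n k : ℕ) : Hr (n + 1) k =
      (if k = 0 then 0 else Hr n (k - 1)) + ((k : ℝ) + r + n * l) * Hr n k := by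
    rcases lt_or_ge k (n + 2) with hk | hk
    · refine sub_eq_zero.1 (eq_zero_of_sum_mul_fallingFactorial_eq_zero (n + 2)
        (fun k => Hr (n + 1) k -
          ((if k = 0 then 0 else Hr n (k - 1)) + ((k : ℝ) + r + n * l) * Hr n k))
        (fun x => ?_) k hk)
      simp only [sub_mul, add_mul _ _ (Finset.prod _ _), Finset.sum_sub_distrib,
        Finset.sum_add_distrib]
      rw [← hHr (n + 1) x, Finset.prod_range_succ, hHr n x, Finset.sum_range_succ' _ (n + 1),
        Finset.sum_range_succ _ (n + 1), hHr0 n (n + 1) n.lt_succ_self]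
      simp only [Nat.add_one_ne_zero, if_false, if_true, Nat.add_sub_cancel, zero_mul, mul_zero,
        add_zero, Finset.prod_range_succ, Finset.sum_mul]
      rw [← Finset.sum_add_distrib, ← Finset.sum_sub_distrib]
      exact Finset.sum_eq_zero fun j _ => by ring
    · rw [hHr0 (n + 1) k (by omega), hHr0 n k (by omega), hHr0 n (k - 1) (by omega)]
      simp
  exact ⟨fun n k => by simpa using key n (k + 1), fun n => by simpa using key n 0⟩
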